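/- Call two K-Bianchi circles tangent if they are distinct (as subsets of ℂ ∪ {∞}) and share exactly one point of ℂ ∪ {∞}. Then the reflexive–transitive closure of the tangency relation relates every pair of K-Bianchi circles (i.e. the Schmidt arrangement is tangency-connected) if and only if Δ ∈ {−3, −4, −7, −8, −11}, i.e. if and only if O_K is a Euclidean domain. -/

import Mathlib

open Complex ComplexConjugate NumberField OnePoint

/-- The finite part of the Möbius image of the extended real line `ℝ̂` under the matrix
`[[α,γ],[β,δ]]`: the set `{(αx+γ)/(βx+δ) : x ∈ ℝ, βx+δ ≠ 0} ∪ {α/β if β ≠ 0}`. -/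
def mobiusFin (α β γ δ : ℂ) : Set ℂ :=
  {z | (∃ x : ℝ, β * (x : ℂ) + δ ≠ 0 ∧ z = (α * x + γ) / (β * x + δ)) ∨ (β ≠ 0 ∧ z = α / β)}

/-- The Möbius image of `ℝ̂ = ℝ ∪ {∞}` in `ℂ ∪ {∞}` under the matrix `[[α,γ],[β,δ]]`;
`∞` belongs to it iff `β = 0` or `δ/β ∈ ℝ`. -/
def mobius (α β γ δ : ℂ) : Set (OnePoint ℂ) :=
  {w | (∃ z ∈ mobiusFin α β γ δ, w = (z : OnePoint ℂ)) ∨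
       ((β = 0 ∨ ∃ x : ℝ, δ = β * (x : ℂ)) ∧ w = ∞)}

/-- The extended real line `ℝ̂ = ℝ ∪ {∞}` as a subset of `ℂ ∪ {∞}`. -/
def rhat : Set (OnePoint ℂ) :=
  {w | (∃ x : ℝ, w = ((x : ℂ) : OnePoint ℂ)) ∨ w = ∞}

/-- The embedding of the ring of integers of `K` into `ℂ` induced by `ι : K →+* ℂ`. -/
noncomputable def emb (K : Type) [Field K] [NumberField K] (ι : K →+* ℂ)
    (x : RingOfIntegers K) : ℂ := ι (algebraMap (RingOfIntegers K) K x)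

/-- The `K`-Bianchi circle attached to `M ∈ SL₂(O_K)`: the Möbius image `M(ℝ̂) ⊆ ℂ ∪ {∞}`. -/
noncomputable def bianchiCircle (K : Type) [Field K] [NumberField K] (ι : K →+* ℂ)
    (M : Matrix.SpecialLinearGroup (Fin 2) (RingOfIntegers K)) : Set (OnePoint ℂ) :=
  mobius (emb K ι (M.1 0 0)) (emb K ι (M.1 1 0)) (emb K ι (M.1 0 1)) (emb K ι (M.1 1 1))

/-- The set of all `K`-Bianchi circles. -/
noncomputable def bianchiSet (K : Type) [Field K] [NumberField K] (ι : K →+* ℂ) :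
    Set (Set (OnePoint ℂ)) :=
  {C | ∃ M : Matrix.SpecialLinearGroup (Fin 2) (RingOfIntegers K), C = bianchiCircle K ι M}

/-- Tangency of `K`-Bianchi circles: two distinct `K`-Bianchi circles sharing exactly one
point of `ℂ ∪ {∞}`. -/
noncomputable def tangent (K : Type) [Field K] [NumberField K] (ι : K →+* ℂ)
    (A B : Set (OnePoint ℂ)) : Prop :=
  A ∈ bianchiSet K ι ∧ B ∈ bianchiSet K ι ∧ A ≠ B ∧ ∃! w : OnePoint ℂ, w ∈ A ∩ B

/-- The ring of integers of a quadratic field is `ℤ[ω]` with `ω ^ 2 = t ω - n`, where `t` may be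
taken to be `0` or `1`. -/
theorem exists_quadratic_generator (K : Type) [Field K] [NumberField K]
    (hdeg : Module.finrank ℚ K = 2) :
    ∃ (ω : 𝓞 K) (t n : ℤ), (t = 0 ∨ t = 1) ∧ ω ^ 2 = t * ω - n ∧
      NumberField.discr K = t ^ 2 - 4 * n ∧ ∀ x : 𝓞 K, ∃ a b : ℤ, x = a + b * ω := by
  have hrank : Module.finrank ℤ (𝓞 K) = 2 := by rw [RingOfIntegers.rank, hdeg]
  let e : Module.Basis (Fin 2) ℤ (𝓞 K) := Module.finBasisOfFinrankEq ℤ (𝓞 K) hrank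
  obtain ⟨u, v, huv⟩ : ∃ u v : ℤ, (1 : 𝓞 K) = u * e 0 + v * e 1 := by
    refine ⟨e.repr 1 0, e.repr 1 1, ?_⟩
    have := e.sum_repr 1
    simpa [Fin.sum_univ_two] using this.symm
  have hcop : IsCoprime u v := by
    rw [Int.isCoprime_iff_gcd_eq_one]
    obtain ⟨u', hu⟩ := Int.gcd_dvd_left u v
    obtain ⟨v', hv⟩ := Int.gcd_dvd_right u v
    set g := Int.gcd u v
    have h1 : e 0 = (g : ℤ) • ((u' * e 0 + v' * e 1) * e 0) := by
      conv_lhs => rw [← one_mul (e 0), huv, hu, hv]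
      simp only [zsmul_eq_mul]
      push_cast
      ring
    have h2 := congrArg (fun x => e.repr x 0) h1
    simp only [_root_.map_smul, Finsupp.smul_apply, Module.Basis.repr_self, Finsupp.single_eq_same,
      smul_eq_mul] at h2
    have h3 : (g : ℤ) ∣ 1 := ⟨_, h2⟩
    exact Nat.dvd_one.1 (by exact_mod_cast h3)
  obtain ⟨p, q, hpq⟩ := hcop
  have hpqK : (p : 𝓞 K) * u + q * v = 1 := by exact_mod_cast hpq
  obtain ⟨ω, hω⟩ : ∃ ω : 𝓞 K, ω = -q * e 0 + p * e 1 := ⟨_, rfl⟩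
  have he0 : e 0 = p - v * ω := by
    linear_combination (-p) * huv + v * hω - hpqK * e 0
  have he1 : e 1 = q + u * ω := by
    linear_combination (-q) * huv - u * hω - hpqK * e 1
  have hspan : ∀ x : 𝓞 K, ∃ a b : ℤ, x = a + b * ω := by
    intro x
    have := e.sum_repr x
    rw [Fin.sum_univ_two, zsmul_eq_mul, zsmul_eq_mul, he0, he1] at this
    refine ⟨e.repr x 0 * p + e.repr x 1 * q, -e.repr x 0 * v + e.repr x 1 * u, ?_⟩
    push_cast
    linear_combination -this
  have hli : ⊤ ≤ Submodule.span ℤ (Set.range ![1, ω]) := by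
    intro x _
    obtain ⟨a, b, rfl⟩ := hspan x
    rw [Matrix.range_cons, Matrix.range_cons, Matrix.range_empty, Set.union_empty,
      Set.singleton_union, Submodule.mem_span_pair]
    exact ⟨a, b, by simp⟩
  let B : Module.Basis (Fin 2) ℤ (𝓞 K) :=
    basisOfTopLeSpanOfCardEqFinrank ![1, ω] hli (by simp [hrank])
  have hB : ⇑B = ![1, ω] := coe_basisOfTopLeSpanOfCardEqFinrank _ _ _
  have hB0 : B 0 = 1 := by simp [hB]
  have hB1 : B 1 = ω := by simp [hB]
  obtain ⟨m, c, hmc⟩ := hspan (ω * ω)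
  have htr1 : Algebra.trace ℤ (𝓞 K) 1 = 2 := by
    rw [Algebra.trace_eq_matrix_trace B]
    simp
  have htrω : Algebra.trace ℤ (𝓞 K) ω = c := by
    rw [Algebra.trace_eq_matrix_trace B, Matrix.trace_fin_two,
      Algebra.leftMulMatrix_eq_repr_mul, Algebra.leftMulMatrix_eq_repr_mul, hB0, mul_one]
    have h1 : B.repr ω 0 = 0 := by rw [← hB1]; simp
    have h2 : ω * B 1 = m • B 0 + c • B 1 := by rw [hB1, hB0, hmc]; simp
    rw [h1, h2, map_add, _root_.map_smul, _root_.map_smul, B.repr_self, B.repr_self]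
    simp
  have htrω2 : Algebra.trace ℤ (𝓞 K) (ω * ω) = 2 * m + c * c := by
    have h2 : ω * ω = m • 1 + c • ω := by rw [hmc]; simp
    rw [h2, map_add, _root_.map_smul, _root_.map_smul, htr1, htrω]
    simp [mul_comm]
  have hd : NumberField.discr K = c ^ 2 + 4 * m := by
    rw [← NumberField.discr_eq_discr K B, Algebra.discr_def, Matrix.det_fin_two]
    simp only [Algebra.traceMatrix_apply, Algebra.traceForm_apply, hB0, hB1, mul_one, one_mul,
      htr1, htrω, htrω2]
    ring
  obtain ⟨j, t, ht, hj⟩ : ∃ j t : ℤ, (t = 0 ∨ t = 1) ∧ c = 2 * j + t :=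
    ⟨c / 2, c % 2, by omega, by omega⟩
  have hmc' : ω * ω = m + (2 * j + t) * ω := by
    rw [hmc, hj]; push_cast; ring
  refine ⟨ω - j, t, -m - t * j - j ^ 2, ht, ?_, ?_, ?_⟩
  · push_cast
    linear_combination hmc'
  · rw [hd, hj]; ring
  · intro x
    obtain ⟨a, b, rfl⟩ := hspan x
    exact ⟨a + b * j, b, by push_cast; ring⟩

/-- The point of `ℂ ∪ {∞}` with homogeneous coordinates `(p, q)`. -/
noncomputable def projPoint (p q : ℂ) : OnePoint ℂ :=
  open Classical in if q = 0 then ∞ else ((p / q : ℂ) : OnePoint ℂ)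

theorem projPoint_eq_iff {p q p' q' : ℂ} (h : p ≠ 0 ∨ q ≠ 0) (h' : p' ≠ 0 ∨ q' ≠ 0) :
    projPoint p q = projPoint p' q' ↔ p * q' = p' * q := by
  unfold projPoint
  by_cases hq : q = 0 <;> by_cases hq' : q' = 0
  · simp [hq, hq']
  · simp_all
  · simp_all
  · simp only [hq, hq', if_false]
    rw [OnePoint.coe_eq_coe, div_eq_div_iff hq hq']

/-- A nonzero vector stays nonzero under a matrix of determinant one. -/
theorem mulVec_ne_zero_of_det_eq_one {α β γ δ p q : ℂ} (hdet : α * δ - γ * β = 1)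
    (h : p ≠ 0 ∨ q ≠ 0) : α * p + γ * q ≠ 0 ∨ β * p + δ * q ≠ 0 := by
  by_contra! hc
  obtain ⟨h1, h2⟩ := hc
  have hp : p = 0 := by linear_combination δ * h1 - γ * h2 - p * hdet
  have hq : q = 0 := by linear_combination α * h2 - β * h1 - q * hdet
  simp_all

/-- The Möbius image of the extended real line, in homogeneous coordinates. -/
theorem mem_mobius_iff {α β γ δ : ℂ} (w : OnePoint ℂ) :
    w ∈ mobius α β γ δ ↔ ∃ x y : ℝ, (x ≠ 0 ∨ y ≠ 0) ∧
      w = projPoint (α * x + γ * y) (β * x + δ * y) := by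
  constructor
  · rintro (⟨z, (⟨x, hx, rfl⟩ | ⟨hβ, rfl⟩), rfl⟩ | ⟨h, rfl⟩)
    · exact ⟨x, 1, by simp, by simp [projPoint, hx]⟩
    · exact ⟨1, 0, by simp, by simp [projPoint, hβ]⟩
    · rcases h with h | ⟨x, h⟩
      · exact ⟨1, 0, by simp, by simp [projPoint, h]⟩
      · exact ⟨-x, 1, by simp, by simp [projPoint, h]⟩
  · rintro ⟨x, y, hxy, rfl⟩
    by_cases hq : β * x + δ * y = 0
    · refine Or.inr ⟨?_, by simp [projPoint, hq]⟩
      by_cases hy : y = 0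
      · left
        simp_all
      · right
        have hy' : (y : ℂ) ≠ 0 := by exact_mod_cast hy
        refine ⟨-x / y, ?_⟩
        push_cast
        field_simp
        linear_combination hq
    · refine Or.inl ⟨(α * x + γ * y) / (β * x + δ * y), ?_, by simp [projPoint, hq]⟩
      by_cases hy : y = 0
      · right
        subst hy
        have hx : (x : ℂ) ≠ 0 := by intro h; simp [h] at hq
        have hβ : β ≠ 0 := by intro h; simp [h] at hq
        refine ⟨hβ, ?_⟩
        simp
        field_simp
      · left
        have hy' : (y : ℂ) ≠ 0 := by exact_mod_cast hy
        have hne : β * ((x / y : ℝ) : ℂ) + δ ≠ 0 := by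
          intro h
          apply hq
          push_cast at h
          field_simp at h
          linear_combination h
        refine ⟨x / y, hne, ?_⟩
        rw [div_eq_div_iff hq hne]
        push_cast
        field_simp

/-- The region of `ℂ ∪ {∞}` outside the circle centred at `c` that is orthogonal to the unit
circle. -/
def ghostExterior (c : ℂ) : Set (OnePoint ℂ) :=
  {w | w = ∞ ∨ ∃ z : ℂ, w = z ∧ 0 < z.re ^ 2 + z.im ^ 2 + 1 - 2 * (c.re * z.re + c.im * z.im)}

/-- The Hermitian form of signature `(1, 1)` vanishing on the circle bounding `ghostExterior c`. -/
noncomputable def ghostForm (c p q : ℂ) : ℝ :=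
  normSq p + normSq q - 2 * (conj c * p * conj q).re

theorem projPoint_mem_ghostExterior_iff (c : ℂ) {p q : ℂ} (h : p ≠ 0 ∨ q ≠ 0) :
    projPoint p q ∈ ghostExterior c ↔ 0 < ghostForm c p q := by
  by_cases hq : q = 0
  · have hp : p ≠ 0 := by simp_all
    simp [projPoint, ghostExterior, ghostForm, hq, normSq_pos, hp]
  · have hpos : 0 < normSq q := normSq_pos.mpr hq
    have key : ghostForm c p q = normSq q * ((p / q).re ^ 2 + (p / q).im ^ 2 + 1
        - 2 * (c.re * (p / q).re + c.im * (p / q).im)) := by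
      obtain ⟨z, hz⟩ : ∃ z, z = p / q := ⟨_, rfl⟩
      have hp : p = z * q := by rw [hz]; field_simp
      rw [← hz, hp]
      simp only [ghostForm, normSq_apply, mul_re, mul_im, conj_re, conj_im]
      ring
    rw [key, mul_pos_iff_of_pos_left hpos]
    simp only [projPoint, hq, if_false, ghostExterior, Set.mem_ofPred_eq, OnePoint.coe_ne_infty,
      false_or]
    constructor
    · rintro ⟨z, hz, h0⟩
      rw [OnePoint.coe_eq_coe] at hz
      rwa [hz]
    · intro h0
      exact ⟨_, rfl, h0⟩

/-- The imaginary part of the off-diagonal entry of the ghost form pulled back along a matrix. -/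
noncomputable def ghostIm (c α β γ δ : ℂ) : ℝ :=
  (conj α * γ + conj β * δ - conj c * γ * conj β - c * conj α * δ).im

/-- A Möbius image of the extended real line whose pulled back ghost form is definite lies on one
side of the ghost circle. -/
theorem mobius_subset_ghostExterior_or {c α β γ δ : ℂ} (hdet : α * δ - γ * β = 1)
    (h : normSq c - 1 < ghostIm c α β γ δ ^ 2) :
    mobius α β γ δ ⊆ ghostExterior c ∨ mobius α β γ δ ⊆ (ghostExterior c)ᶜ := by
  obtain ⟨B, hB⟩ : ∃ B, B =
    (conj α * γ + conj β * δ - conj c * γ * conj β - c * conj α * δ).re := ⟨_, rfl⟩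
  obtain ⟨A, hA⟩ : ∃ A, A = ghostForm c α β := ⟨_, rfl⟩
  obtain ⟨C, hC⟩ : ∃ C, C = ghostForm c γ δ := ⟨_, rfl⟩
  have hform : ∀ x y : ℝ, ghostForm c (α * x + γ * y) (β * x + δ * y) =
      A * x ^ 2 + 2 * B * x * y + C * y ^ 2 := by
    intro x y
    rw [hA, hB, hC]
    simp only [ghostForm, normSq_apply, mul_re, mul_im, conj_re, conj_im, add_re, add_im, sub_re,
      ofReal_re, ofReal_im]
    ring
  have hdisc : 0 < A * C - B ^ 2 := by
    have hn : normSq (α * δ - γ * β) = 1 := by rw [hdet]; simp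
    have hAC : A * C - B ^ 2 = ghostIm c α β γ δ ^ 2 - (normSq c - 1) * normSq (α * δ - γ * β) := by
      rw [hA, hB, hC]
      simp only [ghostForm, ghostIm, normSq_apply, mul_re, mul_im, conj_re, conj_im, add_re, add_im,
        sub_re, sub_im]
      ring
    rw [hAC, hn]
    linarith
  have hA0 : A ≠ 0 := by
    rintro rfl
    nlinarith [sq_nonneg B]
  have hpos : ∀ x y : ℝ, (x ≠ 0 ∨ y ≠ 0) → 0 < A * (A * x ^ 2 + 2 * B * x * y + C * y ^ 2) := by
    intro x y hxy
    have e : A * (A * x ^ 2 + 2 * B * x * y + C * y ^ 2) =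
      (A * x + B * y) ^ 2 + (A * C - B ^ 2) * y ^ 2 := by ring
    rw [e]
    by_cases hy : y = 0
    · have hx : x ≠ 0 := by simp_all
      subst hy
      have : A * x + B * 0 ≠ 0 := by simp [hA0, hx]
      positivity
    · positivity
  have hvec : ∀ x y : ℝ, (x ≠ 0 ∨ y ≠ 0) → α * x + γ * y ≠ 0 ∨ β * x + δ * y ≠ 0 :=
    fun x y hxy => mulVec_ne_zero_of_det_eq_one hdet (by exact_mod_cast hxy)
  rcases lt_or_gt_of_ne hA0 with hneg | hApos
  · right
    intro w hw
    obtain ⟨x, y, hxy, rfl⟩ := (mem_mobius_iff w).1 hw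
    rw [Set.mem_compl_iff, projPoint_mem_ghostExterior_iff c (hvec x y hxy), hform]
    nlinarith [hpos x y hxy]
  · left
    intro w hw
    obtain ⟨x, y, hxy, rfl⟩ := (mem_mobius_iff w).1 hw
    rw [projPoint_mem_ghostExterior_iff c (hvec x y hxy), hform]
    exact (mul_pos_iff_of_pos_left hApos).1 (hpos x y hxy)

/-- A matrix of determinant one acts injectively on homogeneous coordinates. -/
theorem projPoint_mulVec_eq_iff {α β γ δ p q p' q' : ℂ} (hdet : α * δ - γ * β = 1)
    (h : p ≠ 0 ∨ q ≠ 0) (h' : p' ≠ 0 ∨ q' ≠ 0) :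
    projPoint (α * p + γ * q) (β * p + δ * q) = projPoint (α * p' + γ * q') (β * p' + δ * q') ↔
      p * q' = p' * q := by
  rw [projPoint_eq_iff (mulVec_ne_zero_of_det_eq_one hdet h)
    (mulVec_ne_zero_of_det_eq_one hdet h')]
  constructor <;> intro e
  · linear_combination e - (p * q' - p' * q) * hdet
  · linear_combination e + (p * q' - p' * q) * hdet

/-- Translating the extended real line by a non-real number before applying a Möbius map yields a
tangent circle. -/
theorem existsUnique_mem_mobius_inter {α β γ δ τ : ℂ} (hdet : α * δ - γ * β = 1)
    (hτ : τ.im ≠ 0) :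
    mobius α β γ δ ≠ mobius α β (α * τ + γ) (β * τ + δ) ∧
      ∃! w, w ∈ mobius α β γ δ ∩ mobius α β (α * τ + γ) (β * τ + δ) := by
  have key : ∀ x y x' y' : ℝ, (x ≠ 0 ∨ y ≠ 0) → (x' ≠ 0 ∨ y' ≠ 0) →
      projPoint (α * x + γ * y) (β * x + δ * y) =
        projPoint (α * x' + (α * τ + γ) * y') (β * x' + (β * τ + δ) * y') → y = 0 := by
    intro x y x' y' h h' e
    have hv : (x' : ℂ) + τ * y' ≠ 0 ∨ (y' : ℂ) ≠ 0 := by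
      by_cases hy : y' = 0
      · left; simp_all
      · right; exact_mod_cast hy
    rw [show α * x' + (α * τ + γ) * y' = α * (x' + τ * y') + γ * y' by ring,
      show β * x' + (β * τ + δ) * y' = β * (x' + τ * y') + δ * y' by ring,
      projPoint_mulVec_eq_iff hdet (by exact_mod_cast h) hv] at e
    have him := congrArg Complex.im e
    have hre := congrArg Complex.re e
    simp at him hre
    rcases him with (h1 | h1) | h1
    · exact absurd h1 hτ
    · simp_all
    · exact h1
  have hinter : ∀ w ∈ mobius α β γ δ ∩ mobius α β (α * τ + γ) (β * τ + δ), w = projPoint α β := by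
    rintro w ⟨h1, h2⟩
    obtain ⟨x, y, hxy, rfl⟩ := (mem_mobius_iff w).1 h1
    obtain ⟨x', y', hxy', e⟩ := (mem_mobius_iff _).1 h2
    have hy := key x y x' y' hxy hxy' e
    have := (projPoint_mulVec_eq_iff (p := x) (q := y) (p' := 1) (q' := 0) hdet
      (by exact_mod_cast hxy) (by simp)).2 (by simp [hy])
    simpa using this
  refine ⟨?_, projPoint α β, ⟨(mem_mobius_iff _).2 ⟨1, 0, by simp, by simp⟩,
    (mem_mobius_iff _).2 ⟨1, 0, by simp, by simp⟩⟩, hinter⟩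
  intro heq
  have hmem : projPoint (α * (0 : ℝ) + γ * (1 : ℝ)) (β * (0 : ℝ) + δ * (1 : ℝ)) ∈
      mobius α β γ δ := (mem_mobius_iff _).2 ⟨0, 1, by simp, rfl⟩
  rw [heq] at hmem
  obtain ⟨x', y', hxy', e⟩ := (mem_mobius_iff _).1 hmem
  exact one_ne_zero (key 0 1 x' y' (by simp) hxy' e)

/-- The upper unitriangular matrix with off-diagonal entry `w`. -/
def upperUnipotent {R : Type*} [CommRing R] (w : R) : Matrix.SpecialLinearGroup (Fin 2) R :=
  ⟨!![1, w; 0, 1], by simp⟩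

/-- The matrix of the inversion `z ↦ -1 / z`. -/
def inversionMatrix (R : Type*) [CommRing R] : Matrix.SpecialLinearGroup (Fin 2) R :=
  ⟨!![0, -1; 1, 0], by simp⟩

theorem mul_upperUnipotent_val {R : Type*} [CommRing R]
    (M : Matrix.SpecialLinearGroup (Fin 2) R) (w : R) :
    (M * upperUnipotent w).1 =
      !![M.1 0 0, M.1 0 0 * w + M.1 0 1; M.1 1 0, M.1 1 0 * w + M.1 1 1] := by
  rw [Matrix.SpecialLinearGroup.coe_mul, Matrix.eta_fin_two M.1]
  simp [upperUnipotent]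

theorem mul_inversionMatrix_val {R : Type*} [CommRing R]
    (M : Matrix.SpecialLinearGroup (Fin 2) R) :
    (M * inversionMatrix R).1 = !![M.1 0 1, -M.1 0 0; M.1 1 1, -M.1 1 0] := by
  rw [Matrix.SpecialLinearGroup.coe_mul, Matrix.eta_fin_two M.1]
  simp [inversionMatrix]

section Circles

variable {K : Type} [Field K] [NumberField K] (ι : K →+* ℂ)

theorem emb_add (x y : 𝓞 K) : emb K ι (x + y) = emb K ι x + emb K ι y := by simp [emb]

theorem emb_sub (x y : 𝓞 K) : emb K ι (x - y) = emb K ι x - emb K ι y := by simp [emb]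

theorem emb_neg (x : 𝓞 K) : emb K ι (-x) = -emb K ι x := by simp [emb]

theorem emb_mul (x y : 𝓞 K) : emb K ι (x * y) = emb K ι x * emb K ι y := by simp [emb]

theorem emb_intCast (m : ℤ) : emb K ι m = m := by simp [emb]

theorem emb_one : emb K ι 1 = 1 := by simp [emb]

theorem emb_zero : emb K ι 0 = 0 := by simp [emb]

theorem emb_eq_zero_iff (x : 𝓞 K) : emb K ι x = 0 ↔ x = 0 := by simp [emb]

theorem emb_det (M : Matrix.SpecialLinearGroup (Fin 2) (𝓞 K)) :
    emb K ι (M.1 0 0) * emb K ι (M.1 1 1) - emb K ι (M.1 0 1) * emb K ι (M.1 1 0) = 1 := by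
  rw [← emb_mul, ← emb_mul, ← emb_sub, ← Matrix.det_fin_two, M.2, emb_one]

theorem bianchiCircle_mul_inversionMatrix (M : Matrix.SpecialLinearGroup (Fin 2) (𝓞 K)) :
    bianchiCircle K ι (M * inversionMatrix (𝓞 K)) = bianchiCircle K ι M := by
  ext w
  simp only [bianchiCircle, mul_inversionMatrix_val, mem_mobius_iff]
  constructor
  · rintro ⟨x, y, h, rfl⟩
    refine ⟨-y, x, by simpa [or_comm] using h, ?_⟩
    congr 1 <;> simp [emb_neg] <;> ring
  · rintro ⟨x, y, h, rfl⟩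
    refine ⟨y, -x, by simpa [or_comm] using h, ?_⟩
    congr 1 <;> simp [emb_neg] <;> ring

/-- Right multiplication by a unipotent matrix does not leave the tangency component. -/
theorem reflTransGen_tangent_mul_upperUnipotent
    (M : Matrix.SpecialLinearGroup (Fin 2) (𝓞 K)) (w : 𝓞 K) :
    Relation.ReflTransGen (tangent K ι) (bianchiCircle K ι M)
      (bianchiCircle K ι (M * upperUnipotent w)) := by
  by_cases hw : (emb K ι w).im = 0
  · have hw' : emb K ι w = ((emb K ι w).re : ℂ) := Complex.ext (by simp) (by simp [hw])
    have : bianchiCircle K ι (M * upperUnipotent w) = bianchiCircle K ι M := by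
      ext z
      simp only [bianchiCircle, mul_upperUnipotent_val, mem_mobius_iff]
      generalize (emb K ι w).re = r at hw'
      constructor
      · rintro ⟨x, y, h, rfl⟩
        refine ⟨x + r * y, y, ?_, ?_⟩
        · by_contra! hc; obtain ⟨h1, rfl⟩ := hc; simp_all
        · congr 1 <;> simp [emb_add, emb_mul, hw'] <;> ring
      · rintro ⟨x, y, h, rfl⟩
        refine ⟨x - r * y, y, ?_, ?_⟩
        · by_contra! hc; obtain ⟨h1, rfl⟩ := hc; simp_all
        · congr 1 <;> simp [emb_add, emb_mul, hw'] <;> ring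
    rw [this]
  · refine Relation.ReflTransGen.single ⟨⟨_, rfl⟩, ⟨_, rfl⟩, ?_⟩
    have := existsUnique_mem_mobius_inter (emb_det ι M) hw
    rw [← emb_mul, ← emb_add, ← emb_mul, ← emb_add] at this
    simp only [bianchiCircle, mul_upperUnipotent_val]
    exact this

theorem reflTransGen_tangent_symm {A B : Set (OnePoint ℂ)}
    (h : Relation.ReflTransGen (tangent K ι) A B) : Relation.ReflTransGen (tangent K ι) B A := by
  have : Std.Symm (tangent K ι) :=
    ⟨fun _ _ ⟨hA, hB, hne, h⟩ => ⟨hB, hA, hne.symm, by rwa [Set.inter_comm]⟩⟩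
  exact Std.Symm.symm _ _ h

/-- `M` is joined to a given circle as soon as `M * upperUnipotent w * inversionMatrix` is. -/
theorem reflTransGen_of_mul_upperUnipotent_mul_inversion
    {M : Matrix.SpecialLinearGroup (Fin 2) (𝓞 K)} (w : 𝓞 K) {A : Set (OnePoint ℂ)}
    (h : Relation.ReflTransGen (tangent K ι) A
      (bianchiCircle K ι (M * upperUnipotent w * inversionMatrix (𝓞 K)))) :
    Relation.ReflTransGen (tangent K ι) A (bianchiCircle K ι M) := by
  rw [bianchiCircle_mul_inversionMatrix] at h
  exact h.trans (reflTransGen_tangent_symm ι (reflTransGen_tangent_mul_upperUnipotent ι M w))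

/-- Upper triangular matrices lie in the tangency component of the extended real line. -/
theorem reflTransGen_tangent_of_lower_eq_zero (M : Matrix.SpecialLinearGroup (Fin 2) (𝓞 K))
    (hM : M.1 1 0 = 0) :
    Relation.ReflTransGen (tangent K ι) (bianchiCircle K ι 1) (bianchiCircle K ι M) := by
  have hdet : M.1 0 0 * M.1 1 1 = 1 := by
    have := M.2
    rw [Matrix.det_fin_two, hM] at this
    simpa using this
  rw [← bianchiCircle_mul_inversionMatrix ι M]
  refine reflTransGen_of_mul_upperUnipotent_mul_inversion ι (M.1 0 0) ?_
  refine reflTransGen_of_mul_upperUnipotent_mul_inversion ι (M.1 1 1) ?_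
  generalize hN : M * inversionMatrix (𝓞 K) * upperUnipotent (M.1 0 0) * inversionMatrix (𝓞 K) *
    upperUnipotent (M.1 1 1) * inversionMatrix (𝓞 K) = N
  have hN' : N * inversionMatrix (𝓞 K) * inversionMatrix (𝓞 K) = upperUnipotent (-N.1 0 1) := by
    apply Subtype.ext
    have hval := congrArg Subtype.val hN
    simp only [mul_inversionMatrix_val, mul_upperUnipotent_val] at hval ⊢
    rw [← hval]
    simp only [upperUnipotent, Matrix.of_apply, Matrix.cons_val_zero, Matrix.cons_val_one,
      Matrix.cons_val', Matrix.cons_val_fin_one, hM]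
    congr! 3
    · linear_combination (1 - M.1 0 1) * hdet
    · congr! 1
      · linear_combination -M.1 1 1 * hdet
      · congr! 1
        linear_combination hdet
  rw [← bianchiCircle_mul_inversionMatrix ι N, ← bianchiCircle_mul_inversionMatrix ι (N * _), hN']
  simpa using reflTransGen_tangent_mul_upperUnipotent ι 1 (-N.1 0 1)

/-- If division with remainder decreases the absolute value, every Bianchi circle lies in the
tangency component of the extended real line. -/
theorem reflTransGen_tangent_of_euclidean
    (hint : ∀ x : 𝓞 K, ∃ m : ℤ, normSq (emb K ι x) = m)
    (heuc : ∀ a b : 𝓞 K, b ≠ 0 → ∃ q, normSq (emb K ι (b * q + a)) < normSq (emb K ι b))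
    (M : Matrix.SpecialLinearGroup (Fin 2) (𝓞 K)) :
    Relation.ReflTransGen (tangent K ι) (bianchiCircle K ι 1) (bianchiCircle K ι M) := by
  have main : ∀ k : ℕ, ∀ M : Matrix.SpecialLinearGroup (Fin 2) (𝓞 K),
      normSq (emb K ι (M.1 1 0)) < k →
      Relation.ReflTransGen (tangent K ι) (bianchiCircle K ι 1) (bianchiCircle K ι M) := by
    intro k
    induction k with
    | zero => exact fun M h => absurd h (by simpa using normSq_nonneg _)
    | succ k ih =>
      intro M h
      by_cases h0 : M.1 1 0 = 0
      · exact reflTransGen_tangent_of_lower_eq_zero ι M h0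
      · obtain ⟨q, hq⟩ := heuc (M.1 1 1) _ h0
        refine reflTransGen_of_mul_upperUnipotent_mul_inversion ι q (ih _ ?_)
        simp only [mul_inversionMatrix_val, mul_upperUnipotent_val]
        simp only [Matrix.cons_val_zero, Matrix.cons_val_one, Matrix.of_apply, Matrix.cons_val']
        obtain ⟨m₁, hm₁⟩ := hint (M.1 1 0)
        obtain ⟨m₂, hm₂⟩ := hint (M.1 1 0 * q + M.1 1 1)
        rw [hm₁] at h hq
        rw [hm₂] at hq ⊢
        norm_cast at h hq ⊢
        omega
  obtain ⟨k, hk⟩ := exists_nat_gt (normSq (emb K ι (M.1 1 0)))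
  exact main k M hk

section Generator

variable {ω : 𝓞 K} {t n : ℤ}

theorem emb_generator_re_im (hω : ω ^ 2 = t * ω - n) (hpos : 0 < 4 * n - t ^ 2) :
    (emb K ι ω).re = t / 2 ∧ (emb K ι ω).im ^ 2 = n - t ^ 2 / 4 ∧ (emb K ι ω).im ≠ 0 := by
  have h : emb K ι ω * emb K ι ω = t * emb K ι ω - n := by
    rw [← emb_mul, ← pow_two, hω, emb_sub, emb_mul, emb_intCast, emb_intCast]
  have hre := congrArg Complex.re h
  have him := congrArg Complex.im h
  simp only [mul_re, mul_im, sub_re, sub_im, intCast_re, intCast_im] at hre him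
  have hposR : (0 : ℝ) < 4 * n - t ^ 2 := by exact_mod_cast hpos
  have hne : (emb K ι ω).im ≠ 0 := by
    intro h0
    rw [h0] at hre
    nlinarith [sq_nonneg (2 * (emb K ι ω).re - t)]
  have hr : (emb K ι ω).re = t / 2 := by
    have : (emb K ι ω).im * (2 * (emb K ι ω).re - t) = 0 := by linarith
    rcases mul_eq_zero.1 this with h0 | h0
    · exact absurd h0 hne
    · linarith
  refine ⟨hr, ?_, hne⟩
  rw [hr] at hre
  linarith

theorem emb_int_add_int_mul (a b : ℤ) : emb K ι (a + b * ω) = a + b * emb K ι ω := by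
  rw [emb_add, emb_mul, emb_intCast, emb_intCast]

theorem exists_int_eq_normSq_emb (hω : ω ^ 2 = t * ω - n) (hpos : 0 < 4 * n - t ^ 2)
    (hspan : ∀ x : 𝓞 K, ∃ a b : ℤ, x = a + b * ω) (x : 𝓞 K) :
    ∃ m : ℤ, normSq (emb K ι x) = m := by
  obtain ⟨hr, hi, -⟩ := emb_generator_re_im ι hω hpos
  obtain ⟨a, b, rfl⟩ := hspan x
  refine ⟨a ^ 2 + t * a * b + n * b ^ 2, ?_⟩
  rw [emb_int_add_int_mul, normSq_apply]
  simp only [add_re, add_im, mul_re, mul_im, intCast_re, intCast_im, hr]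
  push_cast
  linear_combination (b : ℝ) ^ 2 * hi

/-- Division with remainder for small discriminants. -/
theorem exists_normSq_emb_lt (hω : ω ^ 2 = t * ω - n) (hpos : 0 < 4 * n - t ^ 2)
    (hsmall : 4 * n - t ^ 2 < 12) (a b : 𝓞 K) (hb : b ≠ 0) :
    ∃ q, normSq (emb K ι (b * q + a)) < normSq (emb K ι b) := by
  obtain ⟨hr, hi, hne⟩ := emb_generator_re_im ι hω hpos
  have hb' : emb K ι b ≠ 0 := by rwa [Ne, emb_eq_zero_iff]
  obtain ⟨z, hz⟩ : ∃ z, z = -emb K ι a / emb K ι b := ⟨_, rfl⟩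
  have ha : emb K ι a = -(emb K ι b * z) := by rw [hz]; field_simp
  obtain ⟨v, hv⟩ : ∃ v, v = z.im / (emb K ι ω).im := ⟨_, rfl⟩
  have hzi : z.im = v * (emb K ι ω).im := by rw [hv]; field_simp
  obtain ⟨u, hu⟩ : ∃ u, u = z.re - round v * (t / 2 : ℝ) := ⟨_, rfl⟩
  have hzr : z.re = u + round v * (t / 2 : ℝ) := by linarith
  refine ⟨round u + round v * ω, ?_⟩
  have e : emb K ι (b * (round u + round v * ω) + a) =
      emb K ι b * (round u + round v * emb K ι ω - z) := by
    rw [emb_add, emb_mul, emb_int_add_int_mul, ha]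
    ring
  rw [e, normSq_mul]
  refine mul_lt_of_lt_one_right (normSq_pos.2 hb') ?_
  rw [normSq_apply]
  simp only [sub_re, sub_im, add_re, add_im, mul_re, mul_im, intCast_re, intCast_im, hr, hzr, hzi]
  have hround : ∀ r : ℝ, (r - round r) ^ 2 ≤ (1 / 2) ^ 2 := fun r =>
    sq_le_sq.2 ((abs_sub_round r).trans (le_abs_self _))
  have h3 : (emb K ι ω).im ^ 2 < 3 := by
    have : (4 * n - t ^ 2 : ℝ) < 12 := by exact_mod_cast hsmall
    rw [hi]
    linarith
  nlinarith [hround u, mul_le_mul_of_nonneg_left (hround v) (sq_nonneg (emb K ι ω).im)]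

/-- The order `ℤ[√-3]` is not integrally closed. -/
theorem ne_three_of_generator (ι : K →+* ℂ) (hω : ω ^ 2 = t * ω - n) (hpos : 0 < 4 * n - t ^ 2)
    (hspan : ∀ x : 𝓞 K, ∃ a b : ℤ, x = a + b * ω) : ¬(t = 0 ∧ n = 3) := by
  rintro ⟨rfl, rfl⟩
  obtain ⟨hr, hi, hne⟩ := emb_generator_re_im ι hω hpos
  have hωK : (ω : K) ^ 2 = -3 := by
    have := congrArg (algebraMap (𝓞 K) K) hω
    simpa [map_ofNat] using this
  have hint : IsIntegral ℤ ((1 + (ω : K)) / 2) := by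
    refine ⟨Polynomial.X ^ 2 - Polynomial.X + 1, by monicity!, ?_⟩
    simp
    linear_combination hωK / 4
  obtain ⟨y, hy⟩ : ∃ y : 𝓞 K, (y : K) = (1 + (ω : K)) / 2 := ⟨⟨_, hint⟩, rfl⟩
  obtain ⟨a, b, hab⟩ := hspan y
  have h2 : (2 : 𝓞 K) * (a + b * ω) = 1 + ω := by
    rw [← hab]
    apply RingOfIntegers.coe_injective
    rw [map_mul, map_add, map_one, map_ofNat]
    linear_combination 2 * hy
  have h3 := congrArg (fun x => (emb K ι x).im) h2
  have e : (2 : 𝓞 K) = ((2 : ℤ) : 𝓞 K) := by norm_num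
  simp only [e, emb_mul, emb_add, emb_intCast, emb_one, mul_im, add_im, intCast_re, intCast_im,
    one_im, add_re, mul_re] at h3
  have h4 : (emb K ι ω).im * (2 * b - 1) = 0 := by push_cast at h3; linarith
  rcases mul_eq_zero.1 h4 with h0 | h0
  · exact hne h0
  · have : 2 * b - 1 = 0 := by exact_mod_cast h0
    omega

/-- The centre of the ghost circle: the circumcentre of `0`, `1` and `ω`. -/
noncomputable def ghostCenter (t n : ℤ) (z : ℂ) : ℂ := ⟨1 / 2, (2 * n - t) / (4 * z.im)⟩

/-- No Bianchi circle meets the ghost circle. -/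
theorem bianchiCircle_subset_ghostExterior_or (ht : t = 0 ∨ t = 1) (hω : ω ^ 2 = t * ω - n)
    (hn : 4 ≤ n) (hspan : ∀ x : 𝓞 K, ∃ a b : ℤ, x = a + b * ω)
    (M : Matrix.SpecialLinearGroup (Fin 2) (𝓞 K)) :
    bianchiCircle K ι M ⊆ ghostExterior (ghostCenter t n (emb K ι ω)) ∨
      bianchiCircle K ι M ⊆ (ghostExterior (ghostCenter t n (emb K ι ω)))ᶜ := by
  obtain ⟨hr, hi, hne⟩ := emb_generator_re_im ι hω (by rcases ht with rfl | rfl <;> linarith)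
  have hdet := emb_det ι M
  refine mobius_subset_ghostExterior_or hdet ?_
  obtain ⟨a₁, a₂, hα⟩ := hspan (M.1 0 0)
  obtain ⟨b₁, b₂, hβ⟩ := hspan (M.1 1 0)
  obtain ⟨g₁, g₂, hγ⟩ := hspan (M.1 0 1)
  obtain ⟨d₁, d₂, hδ⟩ := hspan (M.1 1 1)
  simp only [hα, hβ, hγ, hδ, emb_int_add_int_mul] at hdet ⊢
  obtain ⟨h, hh⟩ : ∃ h, h = (emb K ι ω).im := ⟨_, rfl⟩
  obtain ⟨y, hy⟩ : ∃ y, y = (ghostCenter t n (emb K ι ω)).im := ⟨_, rfl⟩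
  have hcr : (ghostCenter t n (emb K ι ω)).re = 1 / 2 := rfl
  rw [← hh] at hi hne
  have hhy : 2 * h * y = n - t / 2 := by
    rw [hy]
    simp only [ghostCenter, ← hh]
    field_simp
    ring
  have hdr := congrArg Complex.re hdet
  have hdi := congrArg Complex.im hdet
  simp only [mul_re, mul_im, sub_re, sub_im, add_re, add_im, intCast_re, intCast_im, hr, ← hh,
    one_re, one_im] at hdr hdi
  obtain ⟨k, hk⟩ : ∃ k : ℤ, k = (a₁ * g₂ - a₂ * g₁) + (b₁ * d₂ - b₂ * d₁) - a₁ * d₂ + g₁ * b₂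
    + n * (g₂ * b₂ - a₂ * d₂) := ⟨_, rfl⟩
  have htt : (t : ℝ) ^ 2 = t := by rcases ht with rfl | rfl <;> norm_num
  have hE : ghostIm (ghostCenter t n (emb K ι ω)) (a₁ + a₂ * emb K ι ω) (b₁ + b₂ * emb K ι ω)
      (g₁ + g₂ * emb K ι ω) (d₁ + d₂ * emb K ι ω) = h * k - y := by
    rw [hk]
    simp only [ghostIm, mul_re, mul_im, sub_im, add_re, add_im, intCast_re, intCast_im, hr,
      ← hh, conj_re, conj_im, hcr, ← hy]
    push_cast
    linear_combination (-y) * hdr + hdi / 2 + h * (g₂ * b₂ - a₂ * d₂) * hhy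
  rw [hE, normSq_apply, hcr, ← hy]
  have hk2 : (h * k - y) ^ 2 = y ^ 2 + (n - t / 4) * k ^ 2 - (n - t / 2) * k := by
    linear_combination k ^ 2 * hi - k * hhy - (k : ℝ) ^ 2 / 4 * htt
  have hnR : (4 : ℝ) ≤ n := by exact_mod_cast hn
  have hkk : (0 : ℝ) ≤ k * (k - 1) := by
    have : 0 ≤ k * (k - 1) := by
      rcases le_or_gt k 0 with h0 | h0
      · exact mul_nonneg_of_nonpos_of_nonpos h0 (by linarith)
      · exact mul_nonneg h0.le (by linarith)
    exact_mod_cast this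
  rw [hk2]
  rcases ht with rfl | rfl
  · push_cast
    nlinarith
  · push_cast
    nlinarith [sq_nonneg ((k : ℝ) - 1)]

/-- Some Bianchi circle passes through the interior of the ghost circle. -/
theorem exists_ghostForm_nonpos (ht : t = 0 ∨ t = 1) (hω : ω ^ 2 = t * ω - n) (hn : 4 ≤ n) :
    ∃ M : Matrix.SpecialLinearGroup (Fin 2) (𝓞 K),
      ghostForm (ghostCenter t n (emb K ι ω)) (emb K ι (M.1 0 0)) (emb K ι (M.1 1 0)) ≤ 0 := by
  obtain ⟨hr, hi, hne⟩ := emb_generator_re_im ι hω (by rcases ht with rfl | rfl <;> linarith)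
  obtain ⟨m, rfl⟩ : ∃ m : ℤ, n = m + 4 := ⟨n - 4, by ring⟩
  have hm : (0 : ℝ) ≤ m := by
    have : 0 ≤ m := by linarith
    exact_mod_cast this
  rcases ht with rfl | rfl
  · refine ⟨⟨!![((m + 5 : ℤ) : 𝓞 K) + (m + 5 : ℤ) * ω,
      -(4 * (m + 5) ^ 2 - 2 * (m + 5) + 1); ((2 * (m + 5) + 1 : ℤ) : 𝓞 K) + (0 : ℤ) * ω,
      -8 * (m + 5) * (1 - ω)], ?_⟩, ?_⟩
    · rw [Matrix.det_fin_two_of]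
      push_cast at hω ⊢
      linear_combination 8 * (m + 5 : 𝓞 K) ^ 2 * hω
    · simp only [Matrix.cons_val_zero, Matrix.cons_val_one, Matrix.of_apply, Matrix.cons_val',
        Matrix.cons_val_fin_one, emb_int_add_int_mul]
      have hcr : (ghostCenter 0 (m + 4) (emb K ι ω)).re = 1 / 2 := rfl
      have hci : (ghostCenter 0 (m + 4) (emb K ι ω)).im * (emb K ι ω).im = (m + 4) / 2 := by
        simp only [ghostCenter]
        push_cast
        field_simp
        ring
      simp only [ghostForm, normSq_apply, mul_re, mul_im, add_re, add_im, intCast_re, intCast_im,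
        hr, conj_re, conj_im, hcr]
      push_cast at hi ⊢
      have : 0 ≤ 4 * (m : ℝ) ^ 3 + 48 * m ^ 2 + 164 * m + 116 := by positivity
      nlinarith
  · refine ⟨⟨!![((((m + 4) * (m + 4) : ℤ)) : 𝓞 K) + ((m + 4) * (2 * (m + 4) - 1) : ℤ) * ω,
      ((m + 4) * (4 * (m + 4) - 1) - 1) * (((m + 4) * (4 * (m + 4) - 1)) ^ 2 + 1);
      (((m + 4) * (4 * (m + 4) - 1) + 1 : ℤ) : 𝓞 K) + (0 : ℤ) * ω,
      (4 * (m + 4) - 1) ^ 3 * (m + 4) * ((m + 4) + (2 * (m + 4) - 1) * (1 - ω))], ?_⟩, ?_⟩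
    · rw [Matrix.det_fin_two_of]
      push_cast at hω ⊢
      linear_combination (-(4 * (m + 4) - 1) ^ 3 * (m + 4) ^ 2 * (2 * (m + 4) - 1) ^ 2 : 𝓞 K) * hω
    · simp only [Matrix.cons_val_zero, Matrix.cons_val_one, Matrix.of_apply, Matrix.cons_val',
        Matrix.cons_val_fin_one, emb_int_add_int_mul]
      have hcr : (ghostCenter 1 (m + 4) (emb K ι ω)).re = 1 / 2 := rfl
      have hci : (ghostCenter 1 (m + 4) (emb K ι ω)).im * (emb K ι ω).im = (2 * m + 7) / 4 := by
        simp only [ghostCenter]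
        push_cast
        field_simp
        ring
      simp only [ghostForm, normSq_apply, mul_re, mul_im, add_re, add_im, intCast_re, intCast_im,
        hr, conj_re, conj_im, hcr]
      push_cast at hi ⊢
      have hpoly : 0 ≤ 4 * (m : ℝ) ^ 5 + 63 * m ^ 4 + 378 * m ^ 3 + 1039 * m ^ 2 + 1178 * m
        + 247 := by positivity
      linear_combination ((m + 4 : ℝ) * (2 * m + 7)) ^ 2 * hi
        - 2 * ((m + 4) * (4 * m + 15) + 1) * ((m + 4) * (2 * m + 7)) * hci + hpoly

/-- For all but finitely many discriminants the ghost circle separates the Bianchi circles. -/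
theorem not_tangency_connected (ht : t = 0 ∨ t = 1) (hω : ω ^ 2 = t * ω - n)
    (hn : 4 ≤ n) (hspan : ∀ x : 𝓞 K, ∃ a b : ℤ, x = a + b * ω)
    (hconn : ∀ M : Matrix.SpecialLinearGroup (Fin 2) (𝓞 K),
      Relation.ReflTransGen (tangent K ι) (bianchiCircle K ι 1) (bianchiCircle K ι M)) : False := by
  obtain ⟨M, hM⟩ := exists_ghostForm_nonpos ι ht hω hn
  have hside := bianchiCircle_subset_ghostExterior_or ι ht hω hn hspan
  have hcol : ∀ N : Matrix.SpecialLinearGroup (Fin 2) (𝓞 K),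
      projPoint (emb K ι (N.1 0 0)) (emb K ι (N.1 1 0)) ∈ bianchiCircle K ι N := fun N =>
    (mem_mobius_iff _).2 ⟨1, 0, by simp, by simp⟩
  generalize ghostCenter t n (emb K ι ω) = c at hM hside
  have hone : bianchiCircle K ι 1 ⊆ ghostExterior c := by
    refine (hside 1).resolve_right fun h => h (hcol 1) ?_
    left
    simp [projPoint, emb_zero]
  have hall : ∀ B, Relation.ReflTransGen (tangent K ι) (bianchiCircle K ι 1) B →
      B ⊆ ghostExterior c := by
    intro B hB
    induction hB with
    | refl => exact hone
    | tail _ h ih =>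
      obtain ⟨-, ⟨N, rfl⟩, -, w, ⟨hw, hw'⟩, -⟩ := h
      exact (hside N).resolve_right fun h => h hw' (ih hw)
  have hv := mulVec_ne_zero_of_det_eq_one (p := 1) (q := 0) (emb_det ι M) (by simp)
  simp only [mul_one, mul_zero, add_zero] at hv
  have := (projPoint_mem_ghostExterior_iff c hv).1 (hall _ (hconn M) (hcol M))
  linarith

end Generator

end Circles

/-- The reflexive–transitive closure of the tangency relation relates
every pair of `K`-Bianchi circles (the Schmidt arrangement is tangency-connected) if and
only if `Δ ∈ {−3, −4, −7, −8, −11}`, i.e. iff `O_K` is a Euclidean domain. -/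
theorem stmt18 (K : Type) [Field K] [NumberField K]
    (hdeg : Module.finrank ℚ K = 2) (hdisc : NumberField.discr K < 0)
    (ι : K →+* ℂ) :
    (∀ A ∈ bianchiSet K ι, ∀ B ∈ bianchiSet K ι,
        Relation.ReflTransGen (tangent K ι) A B)
      ↔ NumberField.discr K ∈ ({-3, -4, -7, -8, -11} : Set ℤ) := by
  obtain ⟨ω, t, n, ht, hω, hD, hspan⟩ := exists_quadratic_generator K hdeg
  have hpos : 0 < 4 * n - t ^ 2 := by linarith
  constructor
  · intro hconn
    by_contra hmem
    have hn : 4 ≤ n := by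
      have hn3 := ne_three_of_generator ι hω hpos hspan
      simp only [hD, Set.mem_insert_iff, Set.mem_singleton_iff] at hmem
      rcases ht with rfl | rfl <;> omega
    exact not_tangency_connected ι ht hω hn hspan fun M => hconn _ ⟨1, rfl⟩ _ ⟨M, rfl⟩
  · intro hmem
    have hsmall : 4 * n - t ^ 2 < 12 := by
      simp only [hD, Set.mem_insert_iff, Set.mem_singleton_iff] at hmem
      omega
    have hstar := reflTransGen_tangent_of_euclidean ι (exists_int_eq_normSq_emb ι hω hpos hspan)
      (exists_normSq_emb_lt ι hω hpos hsmall)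
    rintro _ ⟨M, rfl⟩ _ ⟨N, rfl⟩
    exact (reflTransGen_tangent_symm ι (hstar M)).trans (hstar N)
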